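/- Let σ ∈ [0,1]. If g ∈ G_σ^×(ℝ^p), then its Jacobian determinant J(g) := v ↦ det(dg_v) is everywhere nonzero and both J(g) and 1/J(g) belong to S_σ(ℝ^p), i.e. J(g) ∈ S_σ^×(ℝ^p). Similarly, if g ∈ O_M^×(ℝ^p, ℝ^p), then J(g) is everywhere nonzero and J(g), 1/J(g) ∈ O_M(ℝ^p, ℝ), i.e. J(g) ∈ O_M^×(ℝ^p). -/

import Mathlib

open MeasureTheory
open scoped BigOperators

noncomputable section

/-- Japanese bracket `⟨v⟩ = (1 + ‖v‖²)^(1/2)` (with the Euclidean norm). -/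
def jb {n : ℕ} (v : Fin n → ℝ) : ℝ := Real.sqrt (1 + ∑ i, (v i) ^ 2)

/-- Japanese bracket of a pair of vectors, `⟨(x,y)⟩`. -/
def jb2 {n m : ℕ} (x : Fin n → ℝ) (y : Fin m → ℝ) : ℝ :=
  Real.sqrt (1 + ∑ i, (x i) ^ 2 + ∑ j, (y j) ^ 2)

/-- Euclidean inner product `⟨ϑ, ζ⟩`. -/
def ip {n : ℕ} (ϑ ζ : Fin n → ℝ) : ℝ := ∑ i, ϑ i * ζ i

/-- Partial derivative in the `i`-th coordinate direction. -/
def pd {n : ℕ} {E : Type*} [NormedAddCommGroup E] [NormedSpace ℝ E]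
    (i : Fin n) (f : (Fin n → ℝ) → E) : (Fin n → ℝ) → E :=
  fun x => fderiv ℝ f x (Pi.single i 1)

/-- Iterated partial derivative `∂^ν` along the multi-index `ν`. -/
def pdm {n : ℕ} {E : Type*} [NormedAddCommGroup E] [NormedSpace ℝ E]
    (ν : Fin n → ℕ) (f : (Fin n → ℝ) → E) : (Fin n → ℝ) → E :=
  (List.finRange n).foldr (fun i g => (pd i)^[ν i] g) f

/-- Mixed partial derivative `∂_x^α ∂_y^β` of a function of two vector variables. -/
def pdm2 {n m : ℕ} {E : Type*} [NormedAddCommGroup E] [NormedSpace ℝ E]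
    (α : Fin n → ℕ) (β : Fin m → ℕ) (f : (Fin n → ℝ) → (Fin m → ℝ) → E) :
    (Fin n → ℝ) → (Fin m → ℝ) → E :=
  fun x y => pdm α (fun x' => pdm β (f x') y) x

/-- Mixed partial derivative `∂_x^α ∂_y^β ∂_z^γ` of a function of three vector variables. -/
def pdm3 {n m k : ℕ} {E : Type*} [NormedAddCommGroup E] [NormedSpace ℝ E]
    (α : Fin n → ℕ) (β : Fin m → ℕ) (γ : Fin k → ℕ)
    (f : (Fin n → ℝ) → (Fin m → ℝ) → (Fin k → ℝ) → E) :
    (Fin n → ℝ) → (Fin m → ℝ) → (Fin k → ℝ) → E :=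
  fun x y z => pdm α (fun x' => pdm β (fun y' => pdm γ (f x' y') z) y) x

/-- Length `|ν|` of a multi-index. -/
def msize {n : ℕ} (ν : Fin n → ℕ) : ℕ := ∑ i, ν i

/-- The class `G_σ(ℝ^n, E)`: smooth functions whose `ν`-th derivative is
`O(⟨v⟩^{-σ(|ν|-1)})` for every `ν ≠ 0`. -/
def GsigmaCl {n : ℕ} {E : Type*} [NormedAddCommGroup E] [NormedSpace ℝ E]
    (σ : ℝ) (f : (Fin n → ℝ) → E) : Prop :=
  ContDiff ℝ (⊤ : ℕ∞) f ∧ ∀ ν : Fin n → ℕ, ν ≠ 0 → ∃ C > 0, ∀ v,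
    ‖pdm ν f v‖ ≤ C * jb v ^ (-(σ * ((msize ν : ℝ) - 1)))

/-- The class `S_σ(ℝ^n)`: smooth real functions whose `ν`-th derivative is
`O(⟨v⟩^{-σ|ν|})` for every `ν`. -/
def SsigmaCl {n : ℕ} (σ : ℝ) (f : (Fin n → ℝ) → ℝ) : Prop :=
  ContDiff ℝ (⊤ : ℕ∞) f ∧ ∀ ν : Fin n → ℕ, ∃ C > 0, ∀ v,
    |pdm ν f v| ≤ C * jb v ^ (-(σ * (msize ν : ℝ)))

/-- `G_σ^×(ℝ^p)`: diffeomorphisms `g` of `ℝ^p` with `g` and `g⁻¹` in `G_σ`. -/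
def GsigmaX {p : ℕ} (σ : ℝ) (g : (Fin p → ℝ) → (Fin p → ℝ)) : Prop :=
  ∃ h : (Fin p → ℝ) → (Fin p → ℝ),
    Function.LeftInverse h g ∧ Function.RightInverse h g ∧ GsigmaCl σ g ∧ GsigmaCl σ h

/-- The class `O_M(ℝ^n, E)`: smooth functions with polynomially bounded derivatives. -/
def OMCl {n : ℕ} {E : Type*} [NormedAddCommGroup E] [NormedSpace ℝ E]
    (f : (Fin n → ℝ) → E) : Prop :=
  ContDiff ℝ (⊤ : ℕ∞) f ∧ ∀ ν : Fin n → ℕ, ∃ C > 0, ∃ k : ℕ, ∀ v,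
    ‖pdm ν f v‖ ≤ C * jb v ^ (k : ℝ)

/-- `O_M^×(ℝ^p, ℝ^p)`: diffeomorphisms `g` of `ℝ^p` with `g` and `g⁻¹` in `O_M`. -/
def OMX {p : ℕ} (g : (Fin p → ℝ) → (Fin p → ℝ)) : Prop :=
  ∃ h : (Fin p → ℝ) → (Fin p → ℝ),
    Function.LeftInverse h g ∧ Function.RightInverse h g ∧ OMCl g ∧ OMCl h

/-- The symbol space `S_σ^{l,m}(ℝ^{2n}, E)`. -/
def Ssym {n : ℕ} {E : Type*} [NormedAddCommGroup E] [NormedSpace ℝ E]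
    (σ l m : ℝ) (a : (Fin n → ℝ) → (Fin n → ℝ) → E) : Prop :=
  ContDiff ℝ (⊤ : ℕ∞) (fun q : (Fin n → ℝ) × (Fin n → ℝ) => a q.1 q.2) ∧
  ∀ α β : Fin n → ℕ, ∃ C > 0, ∀ x ϑ,
    ‖pdm2 α β a x ϑ‖ ≤ C * jb x ^ (σ * (l - (msize α : ℝ))) * jb ϑ ^ (m - (msize β : ℝ))

/-- The amplitude space `Π_{σ,κ}^{l,w,m}(ℝ^{3n}, E)`. -/
def Amp {n : ℕ} {E : Type*} [NormedAddCommGroup E] [NormedSpace ℝ E]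
    (σ κ l w m : ℝ) (a : (Fin n → ℝ) → (Fin n → ℝ) → (Fin n → ℝ) → E) : Prop :=
  ContDiff ℝ (⊤ : ℕ∞)
    (fun q : ((Fin n → ℝ) × (Fin n → ℝ)) × (Fin n → ℝ) => a q.1.1 q.1.2 q.2) ∧
  ∀ α β γ : Fin n → ℕ, ∃ C > 0, ∀ x ζ ϑ,
    ‖pdm3 α β γ a x ζ ϑ‖ ≤
      C * jb x ^ (σ * (l - ((msize α + msize β : ℕ) : ℝ))) *
        jb ζ ^ (w + κ * ((msize α + msize β : ℕ) : ℝ)) * jb ϑ ^ (m - (msize γ : ℝ))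

/-- The space `H_{σ,κ}^{w}(E)` of smooth functions on `ℝ^{2n}`. -/
def Hsp {n : ℕ} {F : Type*} [NormedAddCommGroup F] [NormedSpace ℝ F]
    (σ κ w : ℝ) (g : (Fin n → ℝ) → (Fin n → ℝ) → F) : Prop :=
  ContDiff ℝ (⊤ : ℕ∞) (fun q : (Fin n → ℝ) × (Fin n → ℝ) => g q.1 q.2) ∧
  ∀ α β : Fin n → ℕ, ¬(α = 0 ∧ β = 0) → ∃ C > 0, ∀ x ζ,
    ‖pdm2 α β g x ζ‖ ≤ C * jb x ^ (-(σ * (((msize α + msize β : ℕ) : ℝ) - 1))) *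
      jb ζ ^ (w + κ * (((msize α + msize β : ℕ) : ℝ) - 1))

/-- The space `E_{σ,κ}^{w}(E)` of smooth functions on `ℝ^{2n}`. -/
def Esp {n : ℕ} {F : Type*} [NormedAddCommGroup F] [NormedSpace ℝ F]
    (σ κ w : ℝ) (g : (Fin n → ℝ) → (Fin n → ℝ) → F) : Prop :=
  ContDiff ℝ (⊤ : ℕ∞) (fun q : (Fin n → ℝ) × (Fin n → ℝ) => g q.1 q.2) ∧
  ∀ α β : Fin n → ℕ, ∃ C > 0, ∀ x ζ,
    ‖pdm2 α β g x ζ‖ ≤ C * jb x ^ (-(σ * ((msize α + msize β : ℕ) : ℝ))) *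
      jb ζ ^ (w + κ * ((msize α + msize β : ℕ) : ℝ))

/-- Jacobian determinant of a map `ℝ^p → ℝ^p`. -/
def Jdet {p : ℕ} (g : (Fin p → ℝ) → (Fin p → ℝ)) : (Fin p → ℝ) → ℝ :=
  fun v => LinearMap.det (fderiv ℝ g v).toLinearMap

/-- The seminorm `q_{p,(α,β)}(K) = sup ⟨(x,y)⟩^p |∂^{(α,β)} K (x,y)|`. -/
def qSem {n : ℕ} (p : ℕ) (α β : Fin n → ℕ)
    (K : (Fin n → ℝ) → (Fin n → ℝ) → ℂ) : ℝ :=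
  ⨆ q : (Fin n → ℝ) × (Fin n → ℝ), jb2 q.1 q.2 ^ p * ‖pdm2 α β K q.1 q.2‖

/-- Mixed partial derivative `∂_r^α ∂_θ^β` of a function of two real variables. -/
def pd2 (α β : ℕ) (F : ℝ → ℝ → ℝ) (r θ : ℝ) : ℝ :=
  iteratedDeriv α (fun r' => iteratedDeriv β (fun θ' => F r' θ') θ) r

/-- Smooth real function on `ℝ` with all derivatives bounded. -/
def BddSmooth (a : ℝ → ℝ) : Prop :=
  ContDiff ℝ (⊤ : ℕ∞) a ∧ ∀ k : ℕ, ∃ C : ℝ, ∀ t, |iteratedDeriv k a t| ≤ C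

/-- Inverse hyperbolic cosine, `arcosh x = log (x + √(x²-1))`. -/
def arcosh (x : ℝ) : ℝ := Real.log (x + Real.sqrt (x ^ 2 - 1))


/-- Iterated partial derivative along a list of directions. -/
def pdl {n : ℕ} {E : Type*} [NormedAddCommGroup E] [NormedSpace ℝ E]
    (l : List (Fin n)) (f : (Fin n → ℝ) → E) : (Fin n → ℝ) → E :=
  l.foldr (fun i g => pd i g) f

/-- The list of directions attached to a multi-index. -/
def canon {n : ℕ} (ν : Fin n → ℕ) : List (Fin n) :=
  (List.finRange n).flatMap (fun i => List.replicate (ν i) i)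

lemma pdl_append {n : ℕ} {E : Type*} [NormedAddCommGroup E] [NormedSpace ℝ E]
    (l l' : List (Fin n)) (f : (Fin n → ℝ) → E) : pdl (l ++ l') f = pdl l (pdl l' f) := by
  simp [pdl]

lemma pdl_replicate {n : ℕ} {E : Type*} [NormedAddCommGroup E] [NormedSpace ℝ E]
    (k : ℕ) (i : Fin n) (f : (Fin n → ℝ) → E) :
    pdl (List.replicate k i) f = (pd i)^[k] f := by
  induction k with
  | zero => rfl
  | succ k ih =>
    rw [Function.iterate_succ_apply', ← ih]; rfl

lemma pdm_eq_pdl {n : ℕ} {E : Type*} [NormedAddCommGroup E] [NormedSpace ℝ E]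
    (ν : Fin n → ℕ) (f : (Fin n → ℝ) → E) : pdm ν f = pdl (canon ν) f := by
  unfold pdm canon
  induction List.finRange n with
  | nil => rfl
  | cons i l ih =>
    rw [List.flatMap_cons, pdl_append, pdl_replicate, List.foldr_cons, ih]

lemma canon_length {n : ℕ} (ν : Fin n → ℕ) : (canon ν).length = msize ν := by
  simp [canon, msize, List.length_flatMap, Fin.sum_univ_def]

lemma perm_canon {n : ℕ} (l : List (Fin n)) : l.Perm (canon (fun i => l.count i)) := by
  rw [List.perm_iff_count]
  intro a
  unfold canon
  rw [List.count_flatMap]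
  have : (List.count a ∘ fun i => List.replicate (List.count i l) i)
      = fun i => if i = a then List.count a l else 0 := by
    funext i
    by_cases h : i = a
    · subst h; simp
    · simp [h, List.count_replicate]
  rw [this, ← Fin.sum_univ_def]
  simp

lemma pd_smooth {n : ℕ} {E : Type*} [NormedAddCommGroup E] [NormedSpace ℝ E]
    {f : (Fin n → ℝ) → E} (hf : ContDiff ℝ (⊤ : ℕ∞) f) (i : Fin n) :
    ContDiff ℝ (⊤ : ℕ∞) (pd i f) := by
  have : ContDiff ℝ (⊤ : ℕ∞) (fderiv ℝ f) := hf.fderiv_right (by simp)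
  exact this.clm_apply contDiff_const

lemma pdl_smooth {n : ℕ} {E : Type*} [NormedAddCommGroup E] [NormedSpace ℝ E]
    {f : (Fin n → ℝ) → E} (hf : ContDiff ℝ (⊤ : ℕ∞) f) (l : List (Fin n)) :
    ContDiff ℝ (⊤ : ℕ∞) (pdl l f) := by
  induction l with
  | nil => exact hf
  | cons i l ih => exact pd_smooth ih i

lemma pd_comm {n : ℕ} {E : Type*} [NormedAddCommGroup E] [NormedSpace ℝ E]
    {f : (Fin n → ℝ) → E} (hf : ContDiff ℝ (⊤ : ℕ∞) f) (i j : Fin n) :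
    pd i (pd j f) = pd j (pd i f) := by
  have h1 : ContDiff ℝ (⊤ : ℕ∞) (fderiv ℝ f) := hf.fderiv_right (by simp)
  have key : ∀ a b : Fin n, ∀ x, pd a (pd b f) x
      = fderiv ℝ (fderiv ℝ f) x (Pi.single a 1) (Pi.single b 1) := by
    intro a b x
    have hd : DifferentiableAt ℝ (fderiv ℝ f) x := (h1.differentiable (by simp)) x
    change fderiv ℝ (fun y => fderiv ℝ f y (Pi.single b 1)) x (Pi.single a 1) = _
    rw [fderiv_clm_apply hd (differentiableAt_const _)]
    simp
  funext x
  rw [key, key]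
  have hs : IsSymmSndFDerivAt ℝ f x := by
    apply ContDiffAt.isSymmSndFDerivAt hf.contDiffAt
    simp only [minSmoothness_of_isRCLikeNormedField]
    exact WithTop.coe_le_coe.2 le_top
  exact hs _ _

lemma pdl_perm {n : ℕ} {E : Type*} [NormedAddCommGroup E] [NormedSpace ℝ E]
    {f : (Fin n → ℝ) → E} (hf : ContDiff ℝ (⊤ : ℕ∞) f) {l l' : List (Fin n)}
    (h : l.Perm l') : pdl l f = pdl l' f := by
  induction h with
  | nil => rfl
  | cons x _ ih => exact congrArg (pd x) ih
  | swap x y l => exact pd_comm (pdl_smooth hf l) _ _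
  | trans _ _ h1 h2 => exact h1.trans h2

/-- Every list derivative is a multi-index derivative. -/
lemma pdl_eq_pdm {n : ℕ} {E : Type*} [NormedAddCommGroup E] [NormedSpace ℝ E]
    {f : (Fin n → ℝ) → E} (hf : ContDiff ℝ (⊤ : ℕ∞) f) (l : List (Fin n)) :
    ∃ ν : Fin n → ℕ, msize ν = l.length ∧ pdl l f = pdm ν f := by
  refine ⟨fun i => l.count i, ?_, ?_⟩
  · rw [← canon_length, (perm_canon l).length_eq]
  · rw [pdm_eq_pdl]; exact pdl_perm hf (perm_canon l)

/-- Closure rules for a graded family of growth conditions. -/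
structure IsGrowth {n : ℕ} (B : ℕ → ((Fin n → ℝ) → ℝ) → Prop) : Prop where
  add : ∀ k f g, B k f → B k g → B k (fun v => f v + g v)
  mul : ∀ k l f g, B k f → B l g → B (k + l) (fun v => f v * g v)
  const : ∀ c, B 0 (fun _ => c)
  zero : ∀ k, B k (fun _ => 0)

/-- Smooth functions whose derivatives up to order `N` satisfy the growth conditions. -/
def ClN {n : ℕ} (B : ℕ → ((Fin n → ℝ) → ℝ) → Prop) :
    ℕ → ℕ → ((Fin n → ℝ) → ℝ) → Prop
  | 0, k, f => ContDiff ℝ (⊤ : ℕ∞) f ∧ B k f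
  | N + 1, k, f => (ContDiff ℝ (⊤ : ℕ∞) f ∧ B k f) ∧ ∀ i, ClN B N (k + 1) (pd i f)

section
variable {n : ℕ} {B : ℕ → ((Fin n → ℝ) → ℝ) → Prop}

lemma ClN.base {N k : ℕ} {f : (Fin n → ℝ) → ℝ} (h : ClN B N k f) :
    ContDiff ℝ (⊤ : ℕ∞) f ∧ B k f := by
  cases N with
  | zero => exact h
  | succ N => exact h.1

lemma ClN.down {N k : ℕ} {f : (Fin n → ℝ) → ℝ} (h : ClN B (N + 1) k f) : ClN B N k f := by
  induction N generalizing k f with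
  | zero => exact h.1
  | succ N ih => exact ⟨h.1, fun i => ih (h.2 i)⟩

lemma ClN.add (hB : IsGrowth B) {N k : ℕ} {f g : (Fin n → ℝ) → ℝ} (hf : ClN B N k f)
    (hg : ClN B N k g) : ClN B N k (fun v => f v + g v) := by
  induction N generalizing k f g with
  | zero => exact ⟨hf.1.add hg.1, hB.add _ _ _ hf.2 hg.2⟩
  | succ N ih =>
    refine ⟨⟨hf.1.1.add hg.1.1, hB.add _ _ _ hf.1.2 hg.1.2⟩, fun i => ?_⟩
    have : pd i (fun v => f v + g v) = fun v => pd i f v + pd i g v := by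
      funext v
      unfold pd
      rw [fderiv_fun_add (hf.1.1.differentiable (by simp) v) (hg.1.1.differentiable (by simp) v)]
      rfl
    rw [this]
    exact ih (hf.2 i) (hg.2 i)

lemma ClN.mul (hB : IsGrowth B) {N k l : ℕ} {f g : (Fin n → ℝ) → ℝ} (hf : ClN B N k f)
    (hg : ClN B N l g) : ClN B N (k + l) (fun v => f v * g v) := by
  induction N generalizing k l f g with
  | zero => exact ⟨hf.1.mul hg.1, hB.mul _ _ _ _ hf.2 hg.2⟩
  | succ N ih =>
    refine ⟨⟨hf.1.1.mul hg.1.1, hB.mul _ _ _ _ hf.1.2 hg.1.2⟩, fun i => ?_⟩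
    have : pd i (fun v => f v * g v) = fun v => f v * pd i g v + pd i f v * g v := by
      funext v
      unfold pd
      rw [fderiv_fun_mul (hf.1.1.differentiable (by simp) v) (hg.1.1.differentiable (by simp) v)]
      simp [mul_comm]
    rw [this]
    have h3 := ih hf.down (hg.2 i)
    refine ClN.add hB h3 ?_
    have h2 := ih (hf.2 i) hg.down
    rwa [show k + 1 + l = k + l + 1 by omega] at h2

lemma ClN.zero (hB : IsGrowth B) (N k : ℕ) : ClN B N k (fun _ => 0) := by
  induction N generalizing k with
  | zero => exact ⟨contDiff_const, hB.zero k⟩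
  | succ N ih =>
    refine ⟨⟨contDiff_const, hB.zero k⟩, fun i => ?_⟩
    have : pd i (fun _ : Fin n → ℝ => (0 : ℝ)) = fun _ => 0 := by
      funext v; simp [pd]
    rw [this]; exact ih _

lemma ClN.const (hB : IsGrowth B) (N : ℕ) (c : ℝ) : ClN B N 0 (fun _ => c) := by
  cases N with
  | zero => exact ⟨contDiff_const, hB.const c⟩
  | succ N =>
    refine ⟨⟨contDiff_const, hB.const c⟩, fun i => ?_⟩
    have : pd i (fun _ : Fin n → ℝ => c) = fun _ => 0 := by
      funext v; simp [pd]
    rw [this]; exact ClN.zero hB _ _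

lemma ClN.sum (hB : IsGrowth B) {N k : ℕ} {ι : Type*} (s : Finset ι)
    {F : ι → (Fin n → ℝ) → ℝ} (h : ∀ a, ClN B N k (F a)) :
    ClN B N k (fun v => ∑ a ∈ s, F a v) := by
  classical
  induction s using Finset.induction_on with
  | empty => simpa using ClN.zero hB N k
  | insert a s ha ih =>
    simp only [Finset.sum_insert ha]
    exact ClN.add hB (h a) ih

lemma ClN.prod (hB : IsGrowth B) {N : ℕ} {ι : Type*} (s : Finset ι)
    {F : ι → (Fin n → ℝ) → ℝ} (h : ∀ a, ClN B N 0 (F a)) :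
    ClN B N 0 (fun v => ∏ a ∈ s, F a v) := by
  classical
  induction s using Finset.induction_on with
  | empty => simpa using ClN.const hB N 1
  | insert a s ha ih =>
    simp only [Finset.prod_insert ha]
    exact ClN.mul hB (h a) ih

lemma ClN.inv (hB : IsGrowth B) {N : ℕ} {f : (Fin n → ℝ) → ℝ} (hf : ClN B N 0 f)
    (h0 : ∀ v, f v ≠ 0) (hi : B 0 (fun v => (f v)⁻¹)) :
    ClN B N 0 (fun v => (f v)⁻¹) := by
  induction N with
  | zero => exact ⟨hf.1.inv h0, hi⟩
  | succ N ih =>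
    refine ⟨⟨hf.1.1.inv h0, hi⟩, fun i => ?_⟩
    have : pd i (fun v => (f v)⁻¹) = fun v => (-1 * pd i f v) * ((f v)⁻¹ * (f v)⁻¹) := by
      funext v
      unfold pd
      have hd := (hf.1.1.differentiable (by simp) v).hasFDerivAt
      have := (hasDerivAt_inv (h0 v)).comp_hasFDerivAt v hd
      have e : fderiv ℝ (fun v => (f v)⁻¹) v = _ := this.fderiv
      rw [e]
      simp
      field_simp
    rw [this]
    have h1 := ih hf.down
    have h2 := ClN.mul hB (ClN.mul hB (ClN.const hB N (-1)) (hf.2 i)) (ClN.mul hB h1 h1)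
    simpa using h2

lemma ClN.pdl {k : ℕ} {f : (Fin n → ℝ) → ℝ} (hf : ∀ N, ClN B N k f) (l : List (Fin n)) :
    ∀ N, ClN B N (k + l.length) (pdl l f) := by
  induction l with
  | nil => exact hf
  | cons i l ih => exact fun N => (ih (N + 1)).2 i

lemma ClN.pdm {f : (Fin n → ℝ) → ℝ} (hf : ∀ N, ClN B N 0 f) (ν : Fin n → ℕ) :
    B (msize ν) (pdm ν f) := by
  have := (ClN.pdl hf (canon ν) 0).base.2
  rwa [canon_length, ← pdm_eq_pdl, zero_add] at this

lemma pd_coord {p : ℕ} {f : (Fin n → ℝ) → (Fin p → ℝ)} (hf : ContDiff ℝ (⊤ : ℕ∞) f)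
    (i : Fin p) (j : Fin n) : pd j (fun v => f v i) = fun v => pd j f v i := by
  funext v
  unfold pd
  rw [fderiv_apply (hf.differentiable (by simp) v)]
  rfl

lemma ClN.entry {g : (Fin n → ℝ) → (Fin n → ℝ)} (hg : ContDiff ℝ (⊤ : ℕ∞) g) (i : Fin n)
    (H : ∀ ν, ν ≠ 0 → B (msize ν - 1) (fun v => _root_.pdm ν g v i)) (N : ℕ)
    (l : List (Fin n)) (hl : l ≠ []) :
    ClN B N (l.length - 1) (fun v => _root_.pdl l g v i) := by
  have b : ∀ l : List (Fin n), l ≠ [] → ContDiff ℝ (⊤ : ℕ∞) (fun v => _root_.pdl l g v i) ∧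
      B (l.length - 1) (fun v => _root_.pdl l g v i) := by
    intro l hl
    refine ⟨contDiff_pi.1 (pdl_smooth hg l) i, ?_⟩
    obtain ⟨ν, h1, h2⟩ := pdl_eq_pdm hg l
    rw [h2, ← h1]
    apply H
    rintro rfl
    apply hl
    rw [← List.length_eq_zero_iff, ← h1]
    simp [msize]
  induction N generalizing l with
  | zero => exact b l hl
  | succ N ih =>
    refine ⟨b l hl, fun j => ?_⟩
    rw [pd_coord (pdl_smooth hg l)]
    have := ih (j :: l) (by simp)
    have hlen : l.length ≠ 0 := by simpa using hl
    rwa [show (j :: l).length - 1 = l.length - 1 + 1 by simp; omega] at this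

lemma Jdet_eq {p : ℕ} (g : (Fin p → ℝ) → (Fin p → ℝ)) : Jdet g =
    fun v => ∑ s : Equiv.Perm (Fin p), ((Equiv.Perm.sign s : ℤ) : ℝ) *
      ∏ j, pdl [j] g v (s j) := by
  funext v
  unfold Jdet
  rw [← LinearMap.det_toMatrix', Matrix.det_apply']
  refine Finset.sum_congr rfl fun s _ => ?_
  congr 1

lemma ClN.jdet (hB : IsGrowth B) {g : (Fin n → ℝ) → (Fin n → ℝ)}
    (hg : ContDiff ℝ (⊤ : ℕ∞) g)
    (H : ∀ i ν, ν ≠ 0 → B (msize ν - 1) (fun v => _root_.pdm ν g v i)) (N : ℕ) :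
    ClN B N 0 (Jdet g) := by
  rw [Jdet_eq]
  apply ClN.sum hB
  intro s
  refine ClN.mul hB (k := 0) (l := 0) (ClN.const hB N _) (ClN.prod hB _ ?_)
  intro j
  exact ClN.entry hg _ (H _) N [j] (by simp)

end

lemma jdet_inv {p : ℕ} {g h : (Fin p → ℝ) → (Fin p → ℝ)} (hg : ContDiff ℝ (⊤ : ℕ∞) g)
    (hh : ContDiff ℝ (⊤ : ℕ∞) h) (hl : Function.LeftInverse h g) (v : Fin p → ℝ) :
    Jdet h (g v) * Jdet g v = 1 := by
  have h1 := (hh.differentiable (by simp) (g v)).hasFDerivAt.comp v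
    (hg.differentiable (by simp) v).hasFDerivAt
  have e : h ∘ g = id := funext hl
  rw [e] at h1
  have h2 := h1.unique (hasFDerivAt_id v)
  unfold Jdet
  rw [← LinearMap.det_comp, ← ContinuousLinearMap.toLinearMap_comp, h2]
  simp

lemma one_le_jb {n : ℕ} (v : Fin n → ℝ) : 1 ≤ jb v := by
  unfold jb
  rw [Real.one_le_sqrt]
  have : 0 ≤ ∑ i, (v i) ^ 2 := Finset.sum_nonneg fun i _ => sq_nonneg _
  linarith

lemma jb_pos {n : ℕ} (v : Fin n → ℝ) : 0 < jb v := lt_of_lt_of_le one_pos (one_le_jb v)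

/-- Growth condition for `S_σ`. -/
def BS (n : ℕ) (σ : ℝ) (k : ℕ) (f : (Fin n → ℝ) → ℝ) : Prop :=
  ∃ C > 0, ∀ v, |f v| ≤ C * jb v ^ (-(σ * (k : ℝ)))

/-- Growth condition for `O_M`. -/
def BO (n : ℕ) (_ : ℕ) (f : (Fin n → ℝ) → ℝ) : Prop :=
  ∃ C > 0, ∃ k : ℕ, ∀ v, |f v| ≤ C * jb v ^ (k : ℝ)

lemma BS_growth (n : ℕ) (σ : ℝ) : IsGrowth (BS n σ) where
  add := by
    rintro k f g ⟨C, hC, h1⟩ ⟨D, hD, h2⟩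
    refine ⟨C + D, by positivity, fun v => ?_⟩
    rw [add_mul]
    exact (abs_add_le _ _).trans (add_le_add (h1 v) (h2 v))
  mul := by
    rintro k l f g ⟨C, hC, h1⟩ ⟨D, hD, h2⟩
    refine ⟨C * D, by positivity, fun v => ?_⟩
    rw [abs_mul]
    have hp : jb v ^ (-(σ * ((k + l : ℕ) : ℝ)))
        = jb v ^ (-(σ * (k : ℝ))) * jb v ^ (-(σ * (l : ℝ))) := by
      rw [← Real.rpow_add (jb_pos v)]; congr 1; push_cast; ring
    rw [hp, mul_mul_mul_comm]
    exact mul_le_mul (h1 v) (h2 v) (abs_nonneg _) ((abs_nonneg _).trans (h1 v))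
  const := by
    intro c
    refine ⟨|c| + 1, by positivity, fun v => ?_⟩
    simp
  zero := by
    intro k
    refine ⟨1, one_pos, fun v => ?_⟩
    have := jb_pos v
    simp only [abs_zero]
    positivity

lemma BO_growth (n : ℕ) : IsGrowth (BO n) where
  add := by
    rintro _ f g ⟨C, hC, k, h1⟩ ⟨D, hD, l, h2⟩
    refine ⟨C + D, by positivity, k + l, fun v => ?_⟩
    rw [add_mul]
    refine (abs_add_le _ _).trans (add_le_add ((h1 v).trans ?_) ((h2 v).trans ?_))
    · gcongr
      · exact one_le_jb v
      · simp
    · gcongr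
      · exact one_le_jb v
      · simp
  mul := by
    rintro _ _ f g ⟨C, hC, k, h1⟩ ⟨D, hD, l, h2⟩
    refine ⟨C * D, by positivity, k + l, fun v => ?_⟩
    rw [abs_mul]
    have hp : jb v ^ (((k + l : ℕ) : ℝ)) = jb v ^ (k : ℝ) * jb v ^ (l : ℝ) := by
      rw [← Real.rpow_add (jb_pos v)]; congr 1; push_cast; ring
    rw [hp, mul_mul_mul_comm]
    exact mul_le_mul (h1 v) (h2 v) (abs_nonneg _) ((abs_nonneg _).trans (h1 v))
  const := by
    intro c
    refine ⟨|c| + 1, by positivity, 0, fun v => ?_⟩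
    simp
  zero := by
    intro k
    refine ⟨1, one_pos, 0, fun v => ?_⟩
    simp

lemma jb_le {n : ℕ} (w : Fin n → ℝ) : jb w ≤ 1 + n * ‖w‖ := by
  unfold jb
  apply Real.sqrt_le_iff.2
  refine ⟨by positivity, ?_⟩
  have h : ∑ i, (w i) ^ 2 ≤ (n : ℝ) * ‖w‖ ^ 2 := by
    calc ∑ i, (w i) ^ 2 ≤ ∑ _i : Fin n, ‖w‖ ^ 2 := by
          apply Finset.sum_le_sum
          intro i _
          rw [← sq_abs]
          have := norm_le_pi_norm w i
          rw [Real.norm_eq_abs] at this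
          gcongr
      _ = _ := by simp
  have h2 : (n : ℝ) ≤ (n : ℝ) ^ 2 := by
    have : n ≤ n ^ 2 := Nat.le_self_pow (by norm_num) n
    exact_mod_cast this
  have h3 : (n : ℝ) * ‖w‖ ^ 2 ≤ (n : ℝ) ^ 2 * ‖w‖ ^ 2 := by gcongr
  have h4 : 0 ≤ (n : ℝ) * ‖w‖ := by positivity
  nlinarith

lemma pdm_zero' {n : ℕ} {E : Type*} [NormedAddCommGroup E] [NormedSpace ℝ E]
    (f : (Fin n → ℝ) → E) : pdm 0 f = f := by
  have : canon (0 : Fin n → ℕ) = [] := by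
    rw [← List.length_eq_zero_iff, canon_length]; simp [msize]
  rw [pdm_eq_pdl, this]; rfl

lemma BO_comp {n : ℕ} {f : (Fin n → ℝ) → ℝ} {g : (Fin n → ℝ) → (Fin n → ℝ)}
    (hf : BO n 0 f) (hg : OMCl g) : BO n 0 (fun v => f (g v)) := by
  obtain ⟨C, hC, k, h1⟩ := hf
  obtain ⟨D, hD, l, h2⟩ := hg.2 0
  rw [pdm_zero'] at h2
  refine ⟨C * (1 + n * D) ^ k, by positivity, l * k, fun v => ?_⟩
  refine (h1 (g v)).trans ?_
  have h3 : jb (g v) ≤ (1 + n * D) * jb v ^ l := by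
    refine (jb_le _).trans ?_
    have h4 := h2 v
    rw [Real.rpow_natCast] at h4
    have h5 : 1 ≤ jb v ^ l := one_le_pow₀ (one_le_jb v)
    have h6 : (n : ℝ) * ‖g v‖ ≤ n * (D * jb v ^ l) := by gcongr
    nlinarith
  rw [Real.rpow_natCast, Real.rpow_natCast, pow_mul, mul_assoc, ← mul_pow]
  have := jb_pos (g v)
  gcongr

lemma BS_hyp {n : ℕ} {σ : ℝ} {g : (Fin n → ℝ) → (Fin n → ℝ)} (hg : GsigmaCl σ g)
    (i : Fin n) (ν : Fin n → ℕ) (hν : ν ≠ 0) :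
    BS n σ (msize ν - 1) (fun v => pdm ν g v i) := by
  obtain ⟨C, hC, h⟩ := hg.2 ν hν
  have hm : 1 ≤ msize ν := by
    rw [Nat.one_le_iff_ne_zero]
    intro h0
    apply hν
    funext j
    have := (Finset.sum_eq_zero_iff.1 h0) j (Finset.mem_univ j)
    exact this
  refine ⟨C, hC, fun v => ?_⟩
  rw [Nat.cast_sub hm, Nat.cast_one]
  exact (norm_le_pi_norm (pdm ν g v) i).trans (h v)

lemma BO_hyp {n : ℕ} {g : (Fin n → ℝ) → (Fin n → ℝ)} (hg : OMCl g)
    (i : Fin n) (ν : Fin n → ℕ) :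
    BO n (msize ν - 1) (fun v => pdm ν g v i) := by
  obtain ⟨C, hC, k, h⟩ := hg.2 ν
  exact ⟨C, hC, k, fun v => (norm_le_pi_norm (pdm ν g v) i).trans (h v)⟩

/-- The Jacobian determinant of a `G_σ^×` (resp. `O_M^×`)
diffeomorphism is everywhere nonzero and belongs to `S_σ^×(ℝ^p)`
(resp. `O_M^×(ℝ^p)`), i.e. it and its reciprocal lie in `S_σ` (resp. `O_M`). -/
theorem statement3 {p : ℕ} (σ : ℝ) (hσ : σ ∈ Set.Icc (0 : ℝ) 1)
    (g : (Fin p → ℝ) → (Fin p → ℝ)) :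
    (GsigmaX σ g → (∀ v, Jdet g v ≠ 0) ∧ SsigmaCl σ (Jdet g) ∧
      SsigmaCl σ (fun v => (Jdet g v)⁻¹)) ∧
    (OMX g → (∀ v, Jdet g v ≠ 0) ∧ OMCl (Jdet g) ∧
      OMCl (fun v => (Jdet g v)⁻¹)) := by
  constructor
  · rintro ⟨h, hl, -, hg, hh⟩
    have hJ := ClN.jdet (BS_growth p σ) hg.1 (BS_hyp hg)
    have hJh := ClN.jdet (BS_growth p σ) hh.1 (BS_hyp hh)
    have h1 := jdet_inv hg.1 hh.1 hl
    have h0 : ∀ v, Jdet g v ≠ 0 := fun v => right_ne_zero_of_mul_eq_one (h1 v)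
    have hi : BS p σ 0 (fun v => (Jdet g v)⁻¹) := by
      obtain ⟨C, hC, hb⟩ := (hJh 0).2
      refine ⟨C, hC, fun v => ?_⟩
      change |(Jdet g v)⁻¹| ≤ _
      rw [← eq_inv_of_mul_eq_one_left (h1 v)]
      simpa using hb (g v)
    have hI := fun N => ClN.inv (BS_growth p σ) (hJ N) h0 hi
    exact ⟨h0, ⟨(hJ 0).1, fun ν => ClN.pdm hJ ν⟩, ⟨(hI 0).1, fun ν => ClN.pdm hI ν⟩⟩
  · rintro ⟨h, hl, -, hg, hh⟩
    have hJ := ClN.jdet (BO_growth p) hg.1 (fun i ν _ => BO_hyp hg i ν)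
    have hJh := ClN.jdet (BO_growth p) hh.1 (fun i ν _ => BO_hyp hh i ν)
    have h1 := jdet_inv hg.1 hh.1 hl
    have h0 : ∀ v, Jdet g v ≠ 0 := fun v => right_ne_zero_of_mul_eq_one (h1 v)
    have hi : BO p 0 (fun v => (Jdet g v)⁻¹) := by
      have e : (fun v => (Jdet g v)⁻¹) = fun v => Jdet h (g v) :=
        funext fun v => (eq_inv_of_mul_eq_one_left (h1 v)).symm
      rw [e]
      exact BO_comp (hJh 0).2 hg
    have hI := fun N => ClN.inv (BO_growth p) (hJ N) h0 hi
    exact ⟨h0, ⟨(hJ 0).1, fun ν => ClN.pdm hJ ν⟩, ⟨(hI 0).1, fun ν => ClN.pdm hI ν⟩⟩
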